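/- arXiv:1610.04488 — 6 statements merged into one kernel-verified Lean document; each statement's English description precedes it below -/
import Mathlib

section
/- Let d, j, s, l, b be integers with 1 < j < d and s, l, b ≥ 0, and let α be a real number with 0 ≤ α < 1. Then ∫₀¹ t^{j-2+2b+2l} ((1-α²) + α²t²)^{(1-s)/2} (1-t²)^{(d-j-2)/2 + l} dt = [σ_{d-1+2b+4l} / (σ_{j-1+2b+2l} · σ_{d-j+2l})] · ₂F₁((s-1)/2, (d-j+2l)/2; (d-1+2b+4l)/2; α²), and the hypergeometric series converges absolutely. -/
open MeasureTheory Real Filter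

/-- `sphereArea k` is `σ_k = 2 π^{k/2} / Γ(k/2)`, the surface area of the unit sphere
in `ℝ^k`. -/
noncomputable def sphereArea (k : ℝ) : ℝ := 2 * Real.pi ^ (k / 2) / Real.Gamma (k / 2)

/-- The rising factorial (Pochhammer symbol) `(x)_n = x (x+1) ⋯ (x+n-1)`. -/
noncomputable def poch (x : ℝ) (n : ℕ) : ℝ := (ascPochhammer ℝ n).eval x

/-- The Gauss hypergeometric series `₂F₁(a,b;c;z)`. -/
noncomputable def hyp2F1 (a b c z : ℝ) : ℝ :=
  ∑' n : ℕ, poch a n * poch b n / (poch c n * (n.factorial : ℝ)) * z ^ n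

theorem poch_succ (x : ℝ) (n : ℕ) : poch x (n + 1) = poch x n * (x + n) := by
  simp [poch, ascPochhammer_succ_eval]

theorem poch_pos {x : ℝ} (hx : 0 < x) (n : ℕ) : 0 < poch x n :=
  ascPochhammer_pos n x hx

theorem Gamma_add_natCast_eq_mul_poch {x : ℝ} (hx : 0 < x) (n : ℕ) :
    Real.Gamma (x + n) = Real.Gamma x * poch x n := by
  induction n with
  | zero => simp [poch]
  | succ n ih =>
    have h : x + (n : ℝ) ≠ 0 := by positivity
    rw [Nat.cast_succ, ← add_assoc, Real.Gamma_add_one h, ih, poch_succ]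
    ring

theorem choose_add_sub_one_eq_poch_div_factorial (a : ℝ) (n : ℕ) :
    Ring.choose (a + n - 1) n = poch a n / (n.factorial : ℝ) := by
  rw [← Ring.multichoose_eq, eq_div_iff (by positivity), mul_comm, ← nsmul_eq_mul,
    Ring.factorial_nsmul_multichoose_eq_ascPochhammer, Polynomial.ascPochhammer_smeval_eq_eval,
    poch]

/-- The binomial series of `(1 - x) ^ (-a)`. -/
theorem hasSum_poch_div_factorial_mul_pow (a : ℝ) {x : ℝ} (hx : |x| < 1) :
    HasSum (fun n : ℕ => poch a n / (n.factorial : ℝ) * x ^ n) ((1 - x) ^ (-a)) := by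
  have hmem : x ∈ Metric.eball (0 : ℝ) 1 := by
    rw [← ENNReal.ofReal_one, Metric.eball_ofReal]
    simpa using hx
  have h := (Real.one_div_one_sub_rpow_hasFPowerSeriesOnBall_zero a).hasSum hmem
  have h1 : 0 ≤ 1 - x := by linarith [le_abs_self x]
  simpa [FormalMultilinearSeries.ofScalars_apply_eq, choose_add_sub_one_eq_poch_div_factorial,
    Real.rpow_neg h1, mul_comm] using h

theorem integrableOn_and_integral_beta {p q : ℝ} (hp : 0 < p) (hq : 0 < q) :
    IntegrableOn (fun u : ℝ => u ^ (p - 1) * (1 - u) ^ (q - 1)) (Set.Ioo 0 1) ∧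
      ∫ u in Set.Ioo (0 : ℝ) 1, u ^ (p - 1) * (1 - u) ^ (q - 1) =
        Real.Gamma p * Real.Gamma q / Real.Gamma (p + q) := by
  have hcongr : Set.EqOn
      (fun u : ℝ => (u : ℂ) ^ ((p : ℂ) - 1) * (1 - (u : ℂ)) ^ ((q : ℂ) - 1))
      (fun u : ℝ => ((u ^ (p - 1) * (1 - u) ^ (q - 1) : ℝ) : ℂ)) (Set.Ioo 0 1) := by
    intro u hu
    have h0 : 0 ≤ u := hu.1.le
    have h1 : 0 ≤ 1 - u := by linarith [hu.2]
    simp [Complex.ofReal_cpow h0, Complex.ofReal_cpow h1]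
  have hconv := Complex.betaIntegral_convergent (u := p) (v := q) (by simpa) (by simpa)
  rw [intervalIntegrable_iff_integrableOn_Ioo_of_le zero_le_one] at hconv
  refine ⟨by simpa [IntegrableOn] using
    ((integrableOn_congr_fun hcongr measurableSet_Ioo).1 hconv).re, ?_⟩
  have h := ProbabilityTheory.beta_eq_betaIntegralReal p q hp hq
  rw [Complex.betaIntegral, intervalIntegral.integral_of_le zero_le_one,
    integral_Ioc_eq_integral_Ioo, setIntegral_congr_fun measurableSet_Ioo hcongr,
    integral_complex_ofReal, ProbabilityTheory.beta] at h
  simpa using h.symm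

theorem integrableOn_and_integral_rpow_mul_one_sub_sq_rpow {p q : ℝ} (hp : 0 < p) (hq : 0 < q) :
    IntegrableOn (fun t : ℝ => t ^ (2 * p - 1) * (1 - t ^ 2) ^ (q - 1)) (Set.Ioo 0 1) ∧
      ∫ t in Set.Ioo (0 : ℝ) 1, t ^ (2 * p - 1) * (1 - t ^ 2) ^ (q - 1) =
        Real.Gamma p * Real.Gamma q / Real.Gamma (p + q) / 2 := by
  have himage : (fun t : ℝ => t ^ 2) '' Set.Ioo 0 1 = Set.Ioo 0 1 := by
    ext u
    constructor
    · rintro ⟨t, ⟨h0, h1⟩, rfl⟩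
      exact ⟨by positivity, by dsimp only; nlinarith⟩
    · rintro ⟨h0, h1⟩
      exact ⟨√u, ⟨Real.sqrt_pos.2 h0, by rw [Real.sqrt_lt' one_pos]; simpa⟩, Real.sq_sqrt h0.le⟩
  have hderiv : ∀ t ∈ Set.Ioo (0 : ℝ) 1,
      HasDerivWithinAt (fun t : ℝ => t ^ 2) (2 * t) (Set.Ioo 0 1) t := by
    intro t _
    simpa using (hasDerivAt_pow 2 t).hasDerivWithinAt
  have hinj : Set.InjOn (fun t : ℝ => t ^ 2) (Set.Ioo 0 1) := by
    intro s hs t ht h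
    exact (pow_left_inj₀ hs.1.le ht.1.le two_ne_zero).1 h
  have hcongr : Set.EqOn
      (fun t : ℝ => |2 * t| • ((t ^ 2) ^ (p - 1) * (1 - t ^ 2) ^ (q - 1)))
      (fun t : ℝ => 2 * (t ^ (2 * p - 1) * (1 - t ^ 2) ^ (q - 1))) (Set.Ioo 0 1) := by
    intro t ht
    have h0 : 0 < t := ht.1
    have h : t * (t ^ 2) ^ (p - 1) = t ^ (2 * p - 1) := by
      rw [← Real.rpow_natCast, ← Real.rpow_mul h0.le]
      nth_rewrite 1 [← Real.rpow_one t]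
      rw [← Real.rpow_add h0]
      congr 1
      push_cast
      ring
    dsimp only
    rw [abs_of_pos (by positivity), smul_eq_mul, ← h]
    ring
  obtain ⟨hint, hval⟩ := integrableOn_and_integral_beta hp hq
  rw [← himage, integrableOn_image_iff_integrableOn_abs_deriv_smul measurableSet_Ioo hderiv hinj,
    integrableOn_congr_fun hcongr measurableSet_Ioo] at hint
  rw [← himage, integral_image_eq_integral_abs_deriv_smul measurableSet_Ioo hderiv hinj,
    setIntegral_congr_fun measurableSet_Ioo hcongr, integral_const_mul] at hval
  refine ⟨?_, by linarith⟩
  have h := hint.const_mul (1 / 2)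
  simp only [one_div, inv_mul_cancel_left₀ (two_ne_zero' ℝ)] at h
  exact h

/-- Euler's integral representation of `₂F₁`, after the substitution `u = 1 - t ^ 2`. -/
theorem hasSum_integral_hypergeometric (a : ℝ) {p q x : ℝ} (hp : 0 < p) (hq : 0 < q)
    (hx0 : 0 ≤ x) (hx1 : x < 1) :
    HasSum (fun n : ℕ => Real.Gamma p * Real.Gamma q / Real.Gamma (p + q) / 2 *
        (poch a n * poch q n / (poch (p + q) n * (n.factorial : ℝ)) * x ^ n))
      (∫ t in Set.Ioo (0 : ℝ) 1,
        t ^ (2 * p - 1) * ((1 - x) + x * t ^ 2) ^ (-a) * (1 - t ^ 2) ^ (q - 1)) := by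
  set F : ℕ → ℝ → ℝ := fun n t =>
    poch a n / (n.factorial : ℝ) * x ^ n * (t ^ (2 * p - 1) * (1 - t ^ 2) ^ (q + n - 1)) with hF
  have hqn (n : ℕ) : 0 < q + n := by positivity
  have hbeta (n : ℕ) := integrableOn_and_integral_rpow_mul_one_sub_sq_rpow hp (hqn n)
  have hint (n : ℕ) : IntegrableOn (F n) (Set.Ioo 0 1) := (hbeta n).1.const_mul _
  have hnonneg (r : ℝ) {t : ℝ} (ht : t ∈ Set.Ioo (0 : ℝ) 1) :
      0 ≤ t ^ (2 * p - 1) * (1 - t ^ 2) ^ r := by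
    have h0 : 0 < t := ht.1
    have h1 : 0 ≤ 1 - t ^ 2 := by nlinarith [ht.2]
    positivity
  have hnorm (n : ℕ) : ∫ t in Set.Ioo (0 : ℝ) 1, ‖F n t‖ = |poch a n / (n.factorial : ℝ) * x ^ n| *
      ∫ t in Set.Ioo (0 : ℝ) 1, t ^ (2 * p - 1) * (1 - t ^ 2) ^ (q + n - 1) := by
    rw [← integral_const_mul]
    refine setIntegral_congr_fun measurableSet_Ioo fun t ht => ?_
    simp only [hF]
    rw [Real.norm_eq_abs, abs_mul, abs_of_nonneg (hnonneg _ ht)]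
  have hbinom (y : ℝ) (hy0 : 0 ≤ y) (hy1 : y < 1) :=
    hasSum_poch_div_factorial_mul_pow a (x := y) (by rwa [abs_of_nonneg hy0])
  have hsum : Summable fun n => ∫ t in Set.Ioo (0 : ℝ) 1, ‖F n t‖ := by
    refine Summable.of_nonneg_of_le (fun n => integral_nonneg fun t => norm_nonneg _) (fun n => ?_)
      ((hbinom x hx0 hx1).summable.abs.mul_right
        (∫ t in Set.Ioo (0 : ℝ) 1, t ^ (2 * p - 1) * (1 - t ^ 2) ^ (q - 1)))
    rw [hnorm]
    refine mul_le_mul_of_nonneg_left ?_ (abs_nonneg _)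
    refine setIntegral_mono_on (hbeta n).1
      (integrableOn_and_integral_rpow_mul_one_sub_sq_rpow hp hq).1 measurableSet_Ioo fun t ht => ?_
    have h0 : 0 < t := ht.1
    have h1 : 0 < 1 - t ^ 2 := by nlinarith [ht.2]
    refine mul_le_mul_of_nonneg_left ?_ (by positivity)
    exact Real.rpow_le_rpow_of_exponent_ge h1 (by nlinarith) (by linarith [n.cast_nonneg (α := ℝ)])
  have h := hasSum_integral_of_summable_integral_norm hint hsum
  have hval : ∫ t in Set.Ioo (0 : ℝ) 1,
      t ^ (2 * p - 1) * ((1 - x) + x * t ^ 2) ^ (-a) * (1 - t ^ 2) ^ (q - 1) =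
      ∫ t in Set.Ioo (0 : ℝ) 1, ∑' n, F n t := by
    refine setIntegral_congr_fun measurableSet_Ioo fun t ht => ?_
    have h1 : 0 < 1 - t ^ 2 := by nlinarith [ht.1, ht.2]
    have h2 : x * (1 - t ^ 2) < 1 := by nlinarith [ht.1, ht.2]
    have hs := (hbinom _ (mul_nonneg hx0 h1.le) h2).mul_left
      (t ^ (2 * p - 1) * (1 - t ^ 2) ^ (q - 1))
    rw [show 1 - x * (1 - t ^ 2) = (1 - x) + x * t ^ 2 by ring] at hs
    rw [mul_right_comm, ← hs.tsum_eq]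
    refine tsum_congr fun n => ?_
    simp only [hF]
    rw [show q + n - 1 = q - 1 + n by ring, Real.rpow_add_natCast h1.ne', mul_pow]
    ring
  rw [hval]
  convert! h using 2 with n
  simp only [hF]
  rw [integral_const_mul, (hbeta n).2, ← add_assoc, Gamma_add_natCast_eq_mul_poch hq,
    Gamma_add_natCast_eq_mul_poch (add_pos hp hq)]
  have h1 := (Real.Gamma_pos_of_pos (add_pos hp hq)).ne'
  have h2 := (poch_pos (add_pos hp hq) n).ne'
  field_simp

theorem sphereArea_div_sphereArea_mul_sphereArea {p q : ℝ} (hp : 0 < p) (hq : 0 < q) :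
    sphereArea (2 * (p + q)) / (sphereArea (2 * p) * sphereArea (2 * q)) =
      Real.Gamma p * Real.Gamma q / Real.Gamma (p + q) / 2 := by
  have h (r : ℝ) : 2 * r / 2 = r := by ring
  simp only [sphereArea, h]
  rw [Real.rpow_add Real.pi_pos]
  have h1 := (Real.Gamma_pos_of_pos hp).ne'
  have h2 := (Real.Gamma_pos_of_pos hq).ne'
  have h3 := (Real.Gamma_pos_of_pos (add_pos hp hq)).ne'
  have h4 := (Real.rpow_pos_of_pos Real.pi_pos p).ne'
  have h5 := (Real.rpow_pos_of_pos Real.pi_pos q).ne'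
  field_simp

theorem statement0 (d j s l b : ℕ) (hj : 1 < j) (hjd : j < d) (α : ℝ)
    (hα0 : 0 ≤ α) (hα1 : α < 1) :
    (∫ t in Set.Ioo (0 : ℝ) 1,
        t ^ ((j : ℝ) - 2 + 2 * b + 2 * l) *
          ((1 - α ^ 2) + α ^ 2 * t ^ 2) ^ ((1 - (s : ℝ)) / 2) *
          (1 - t ^ 2) ^ (((d : ℝ) - j - 2) / 2 + l)) =
      sphereArea ((d : ℝ) - 1 + 2 * b + 4 * l) /
          (sphereArea ((j : ℝ) - 1 + 2 * b + 2 * l) * sphereArea ((d : ℝ) - j + 2 * l)) *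
        hyp2F1 (((s : ℝ) - 1) / 2) (((d : ℝ) - j + 2 * l) / 2)
          (((d : ℝ) - 1 + 2 * b + 4 * l) / 2) (α ^ 2) ∧
    Summable (fun n : ℕ =>
      |poch (((s : ℝ) - 1) / 2) n * poch (((d : ℝ) - j + 2 * l) / 2) n /
          (poch (((d : ℝ) - 1 + 2 * b + 4 * l) / 2) n * (n.factorial : ℝ)) * (α ^ 2) ^ n|) := by
  have hj' : (1 : ℝ) < j := by exact_mod_cast hj
  have hjd' : (j : ℝ) < d := by exact_mod_cast hjd
  obtain ⟨p, hp⟩ : ∃ p : ℝ, p = ((j : ℝ) - 1 + 2 * b + 2 * l) / 2 := ⟨_, rfl⟩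
  obtain ⟨q, hq⟩ : ∃ q : ℝ, q = ((d : ℝ) - j + 2 * l) / 2 := ⟨_, rfl⟩
  have hl : (0 : ℝ) ≤ l := l.cast_nonneg
  have hb : (0 : ℝ) ≤ b := b.cast_nonneg
  have hp0 : 0 < p := by rw [hp]; linarith
  have hq0 : 0 < q := by rw [hq]; linarith
  have h := hasSum_integral_hypergeometric (((s : ℝ) - 1) / 2) hp0 hq0 (sq_nonneg α)
    (by nlinarith : α ^ 2 < 1)
  rw [show (j : ℝ) - 2 + 2 * b + 2 * l = 2 * p - 1 by rw [hp]; ring,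
    show (1 - (s : ℝ)) / 2 = -(((s : ℝ) - 1) / 2) by ring,
    show ((d : ℝ) - j - 2) / 2 + l = q - 1 by rw [hq]; ring,
    show (d : ℝ) - 1 + 2 * b + 4 * l = 2 * (p + q) by rw [hp, hq]; ring,
    show (j : ℝ) - 1 + 2 * b + 2 * l = 2 * p by rw [hp]; ring,
    show (d : ℝ) - j + 2 * l = 2 * q by rw [hq]; ring,
    show 2 * q / 2 = q by ring, show 2 * (p + q) / 2 = p + q by ring,
    sphereArea_div_sphereArea_mul_sphereArea hp0 hq0, hyp2F1, ← tsum_mul_left]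
  have hc : Real.Gamma p * Real.Gamma q / Real.Gamma (p + q) / 2 ≠ 0 := by
    have h1 := Real.Gamma_pos_of_pos hp0
    have h2 := Real.Gamma_pos_of_pos hq0
    have h3 := Real.Gamma_pos_of_pos (add_pos hp0 hq0)
    positivity
  exact ⟨h.tsum_eq.symm, ((summable_mul_left_iff hc).1 h.summable).abs⟩
end

section
/- Let d, j, s, b, l be integers with 1 < j < d, b ≥ 0, l ≥ 0, and s > b + 2l. Then lim_{α→1⁻} (1-α²)^{(s-b-2l)/2} · ∫₀¹ (1-t)^{(j-3+2b+2l)/2} (1-α²t)^{(1-s)/2} t^{(d-j-2+2l)/2} dt = 0, where the limit is taken as α increases to 1 with α ∈ [0,1). -/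
open MeasureTheory Real Filter

theorem integrableOn_rpow_neg_half_mul_one_sub_rpow_neg_half :
    IntegrableOn (fun t : ℝ => (1 - t) ^ (-(1 / 2) : ℝ) * t ^ (-(1 / 2) : ℝ)) (Set.Ioo 0 1) := by
  have h := (Complex.betaIntegral_convergent (u := 1 / 2) (v := 1 / 2)
    (by norm_num) (by norm_num)).norm
  rw [intervalIntegrable_iff_integrableOn_Ioo_of_le zero_le_one] at h
  refine h.congr_fun (fun t ht => ?_) measurableSet_Ioo
  have h1 : ((1 : ℂ) - (t : ℂ)) = ((1 - t : ℝ) : ℂ) := by push_cast; rfl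
  dsimp only
  rw [norm_mul, h1, Complex.norm_cpow_eq_rpow_re_of_pos ht.1,
    Complex.norm_cpow_eq_rpow_re_of_pos (sub_pos.2 ht.2), mul_comm]
  norm_num

/-- If `0 < u ≤ y ≤ 1` and `0 < x ≤ y`, the factor `x ^ p * y ^ q` can be traded for a small power
of `x` and an integrable power of `u`. -/
theorem rpow_mul_rpow_mul_rpow_le {x y u p q a : ℝ} (hx : 0 < x) (hu : 0 < u) (hxy : x ≤ y)
    (huy : u ≤ y) (hy : y ≤ 1) (hp : 1 / 4 ≤ p) (ha : -(1 / 2) ≤ a)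
    (hapq : -(1 / 4) ≤ a + p + q) :
    x ^ p * (u ^ a * y ^ q) ≤ x ^ (1 / 4 : ℝ) * u ^ (-(1 / 2) : ℝ) := by
  have hy0 : 0 < y := hx.trans_le hxy
  have hu1 : u ≤ 1 := huy.trans hy
  have hxp : x ^ p ≤ x ^ (1 / 4 : ℝ) * y ^ (p - 1 / 4) := by
    calc x ^ p = x ^ (1 / 4 : ℝ) * x ^ (p - 1 / 4) := by rw [← rpow_add hx]; congr 1; ring
      _ ≤ _ := by gcongr
  have key : u ^ a * y ^ (p - 1 / 4 + q) ≤ u ^ (-(1 / 2) : ℝ) := by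
    rcases le_total 0 (p - 1 / 4 + q) with h | h
    · calc u ^ a * y ^ (p - 1 / 4 + q) ≤ u ^ a * 1 := by
            gcongr; exact rpow_le_one hy0.le hy h
        _ ≤ _ := by rw [mul_one]; exact rpow_le_rpow_of_exponent_ge hu hu1 ha
    · calc u ^ a * y ^ (p - 1 / 4 + q) ≤ u ^ a * u ^ (p - 1 / 4 + q) := by
            gcongr u ^ a * ?_; exact rpow_le_rpow_of_nonpos hu huy h
        _ = u ^ (a + (p - 1 / 4 + q)) := (rpow_add hu _ _).symm
        _ ≤ _ := rpow_le_rpow_of_exponent_ge hu hu1 (by linarith)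
  calc x ^ p * (u ^ a * y ^ q) ≤ x ^ (1 / 4 : ℝ) * y ^ (p - 1 / 4) * (u ^ a * y ^ q) := by gcongr
    _ = x ^ (1 / 4 : ℝ) * (u ^ a * y ^ (p - 1 / 4 + q)) := by rw [rpow_add hy0]; ring
    _ ≤ _ := by gcongr

theorem statement1 (d j s b l : ℕ) (hj : 1 < j) (hjd : j < d) (hs : b + 2 * l < s) :
    Filter.Tendsto (fun α : ℝ =>
        (1 - α ^ 2) ^ (((s : ℝ) - b - 2 * l) / 2) *
          ∫ t in Set.Ioo (0 : ℝ) 1,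
            (1 - t) ^ (((j : ℝ) - 3 + 2 * b + 2 * l) / 2) *
              (1 - α ^ 2 * t) ^ ((1 - (s : ℝ)) / 2) *
              t ^ (((d : ℝ) - j - 2 + 2 * l) / 2))
      (nhdsWithin 1 (Set.Ico (0 : ℝ) 1)) (nhds 0) := by
  have hj' : (2 : ℝ) ≤ j := by exact_mod_cast hj
  have hjd' : (j : ℝ) + 1 ≤ d := by exact_mod_cast hjd
  have hs' : (b : ℝ) + 2 * l + 1 ≤ s := by exact_mod_cast hs
  have hb : (0 : ℝ) ≤ b := b.cast_nonneg
  have hl : (0 : ℝ) ≤ l := l.cast_nonneg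
  have hbase : ∀ α ∈ Set.Ico (0 : ℝ) 1, ∀ t ∈ Set.Ioo (0 : ℝ) 1,
      0 < 1 - α ^ 2 ∧ 1 - α ^ 2 ≤ 1 - α ^ 2 * t ∧ 1 - t ≤ 1 - α ^ 2 * t ∧
        1 - α ^ 2 * t ≤ 1 := by
    rintro α ⟨hα0, hα1⟩ t ⟨ht0, ht1⟩
    have hα : α ^ 2 < 1 := by nlinarith
    refine ⟨by linarith, ?_, ?_, ?_⟩ <;> nlinarith [sq_nonneg α]
  set K : ℝ := ∫ t in Set.Ioo (0 : ℝ) 1, (1 - t) ^ (-(1 / 2) : ℝ) * t ^ (-(1 / 2) : ℝ)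
  have hlim : Tendsto (fun α : ℝ => (1 - α ^ 2) ^ (1 / 4 : ℝ) * K)
      (nhdsWithin 1 (Set.Ico (0 : ℝ) 1)) (nhds 0) := by
    have hc : Continuous fun α : ℝ => (1 - α ^ 2) ^ (1 / 4 : ℝ) * K :=
      ((continuous_const.sub (continuous_pow 2)).rpow_const
        fun _ => Or.inr (by norm_num)).mul_const K
    have h := (hc.tendsto 1).mono_left (nhdsWithin_le_nhds (s := Set.Ico (0 : ℝ) 1))
    simpa using h
  refine squeeze_zero' ?_ ?_ hlim
  · filter_upwards [self_mem_nhdsWithin] with α hα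
    have hα2 : 0 ≤ 1 - α ^ 2 := by nlinarith [hα.1, hα.2]
    refine mul_nonneg (rpow_nonneg hα2 _) (setIntegral_nonneg measurableSet_Ioo fun t ht => ?_)
    obtain ⟨h0, h1, -, -⟩ := hbase α hα t ht
    exact mul_nonneg (mul_nonneg (rpow_nonneg (sub_nonneg.2 ht.2.le) _)
      (rpow_nonneg (h0.le.trans h1) _)) (rpow_nonneg ht.1.le _)
  · filter_upwards [self_mem_nhdsWithin] with α hα
    rw [← integral_const_mul, ← integral_const_mul]
    refine integral_mono_of_nonneg ?_
      (integrableOn_rpow_neg_half_mul_one_sub_rpow_neg_half.const_mul _) ?_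
    · filter_upwards [ae_restrict_mem measurableSet_Ioo] with t ht
      obtain ⟨h0, h1, -, -⟩ := hbase α hα t ht
      exact mul_nonneg (rpow_nonneg h0.le _) (mul_nonneg (mul_nonneg
        (rpow_nonneg (sub_nonneg.2 ht.2.le) _) (rpow_nonneg (h0.le.trans h1) _))
        (rpow_nonneg ht.1.le _))
    · filter_upwards [ae_restrict_mem measurableSet_Ioo] with t ht
      obtain ⟨h0, h1, h2, h3⟩ := hbase α hα t ht
      have hu : 0 < 1 - t := sub_pos.2 ht.2
      refine (mul_assoc _ _ _).symm.trans_le ((mul_le_mul (rpow_mul_rpow_mul_rpow_le h0 hu h1 h2 h3 ?_ ?_ ?_)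
        (rpow_le_rpow_of_exponent_ge ht.1 ht.2.le ?_) (rpow_nonneg ht.1.le _)
        (mul_nonneg (rpow_nonneg h0.le _) (rpow_nonneg hu.le _))).trans_eq (mul_assoc _ _ _)) <;> linarith
end

section
/- Let d, j, s, b, l be integers with 1 < j < d, b ≥ 0, l ≥ 0, and s > b + 2l. Then for every α ∈ [0,1), (1-α²)^{(s-b-2l)/2} · ∫₀¹ (1-t)^{(j-3+2b+2l)/2} (1-α²t)^{(1-s)/2} t^{(d-j-2+2l)/2} dt ≤ (1-α²)^{1/2} · ∫₀¹ (1-t)^{(j-3+b)/2} t^{(d-j-2+2l)/2} dt, and the integral on the right-hand side is finite. -/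
open MeasureTheory Real Filter

lemma integrableOn_one_sub_rpow_mul_rpow {p q : ℝ} (hp : -1 < p) (hq : -1 < q) :
    IntegrableOn (fun t : ℝ => (1 - t) ^ p * t ^ q) (Set.Ioo 0 1) := by
  have h := Complex.betaIntegral_convergent (u := ((q + 1 : ℝ) : ℂ)) (v := ((p + 1 : ℝ) : ℂ))
    (by rw [Complex.ofReal_re]; linarith) (by rw [Complex.ofReal_re]; linarith)
  rw [intervalIntegrable_iff_integrableOn_Ioo_of_le zero_le_one] at h
  refine IntegrableOn.congr_fun h.norm (fun t ht => ?_) measurableSet_Ioo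
  have h1 : (0 : ℝ) < 1 - t := sub_pos.2 ht.2
  have h2 : ‖(1 - (t : ℂ)) ^ (((p + 1 : ℝ) : ℂ) - 1)‖ = (1 - t) ^ p := by
    rw [← Complex.ofReal_one, ← Complex.ofReal_sub, Complex.norm_cpow_eq_rpow_re_of_pos h1]
    simp
  have h3 : ‖(t : ℂ) ^ (((q + 1 : ℝ) : ℂ) - 1)‖ = t ^ q := by
    rw [Complex.norm_cpow_eq_rpow_re_of_pos ht.1]
    simp
  simp only [norm_mul, h2, h3]
  exact mul_comm _ _

lemma rpow_mul_rpow_mul_rpow_neg_le {x y z m n : ℝ} (hx : 0 ≤ x) (hy : 0 ≤ y) (hxz : x ≤ z)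
    (hyz : y ≤ z) (hz : 0 < z) (hm : 0 ≤ m) (hn : 0 ≤ n) :
    x ^ m * y ^ n * z ^ (-(m + n)) ≤ 1 := by
  calc x ^ m * y ^ n * z ^ (-(m + n)) ≤ z ^ m * z ^ n * z ^ (-(m + n)) := by gcongr
    _ = 1 := by rw [← rpow_add hz, ← rpow_add hz, add_neg_cancel, rpow_zero]

theorem statement2 (d j s b l : ℕ) (hj : 1 < j) (hjd : j < d) (hs : b + 2 * l < s) :
    (∀ α : ℝ, α ∈ Set.Ico (0 : ℝ) 1 →
      (1 - α ^ 2) ^ (((s : ℝ) - b - 2 * l) / 2) *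
          ∫ t in Set.Ioo (0 : ℝ) 1,
            (1 - t) ^ (((j : ℝ) - 3 + 2 * b + 2 * l) / 2) *
              (1 - α ^ 2 * t) ^ ((1 - (s : ℝ)) / 2) *
              t ^ (((d : ℝ) - j - 2 + 2 * l) / 2) ≤
        (1 - α ^ 2) ^ ((1 : ℝ) / 2) *
          ∫ t in Set.Ioo (0 : ℝ) 1,
            (1 - t) ^ (((j : ℝ) - 3 + b) / 2) * t ^ (((d : ℝ) - j - 2 + 2 * l) / 2)) ∧
    IntegrableOn
      (fun t : ℝ => (1 - t) ^ (((j : ℝ) - 3 + b) / 2) * t ^ (((d : ℝ) - j - 2 + 2 * l) / 2))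
      (Set.Ioo 0 1) := by
  have hj' : (2 : ℝ) ≤ j := by exact_mod_cast hj
  have hd' : (j : ℝ) + 1 ≤ d := by exact_mod_cast hjd
  have hs' : (b : ℝ) + 2 * l + 1 ≤ s := by exact_mod_cast hs
  have hb : (0 : ℝ) ≤ b := b.cast_nonneg
  have hl : (0 : ℝ) ≤ l := l.cast_nonneg
  have hint := integrableOn_one_sub_rpow_mul_rpow (p := ((j : ℝ) - 3 + b) / 2)
    (q := ((d : ℝ) - j - 2 + 2 * l) / 2) (by linarith) (by linarith)
  refine ⟨fun α hα => ?_, hint⟩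
  have hα2 : 0 < 1 - α ^ 2 := by nlinarith [hα.1, hα.2]
  rw [← integral_const_mul, ← integral_const_mul]
  have hpos : ∀ t ∈ Set.Ioo (0 : ℝ) 1, 0 < 1 - t ∧ 1 - t ≤ 1 - α ^ 2 * t ∧
      1 - α ^ 2 ≤ 1 - α ^ 2 * t := fun t ht =>
    ⟨sub_pos.2 ht.2, by nlinarith [ht.1], by nlinarith [ht.2, sq_nonneg α]⟩
  refine integral_mono_of_nonneg ?_ (hint.const_mul _) ?_
  · refine (ae_restrict_iff' measurableSet_Ioo).2 (ae_of_all _ fun t ht => ?_)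
    obtain ⟨h1, h2, -⟩ := hpos t ht
    have h3 := h1.trans_le h2
    have h4 := ht.1
    simp only [Pi.zero_apply]
    positivity
  · refine (ae_restrict_iff' measurableSet_Ioo).2 (ae_of_all _ fun t ht => ?_)
    obtain ⟨h1, h2, h3⟩ := hpos t ht
    have h4 := ht.1
    have key := rpow_mul_rpow_mul_rpow_neg_le (m := ((s : ℝ) - b - 2 * l - 1) / 2)
      (n := ((b : ℝ) + 2 * l) / 2) hα2.le h1.le h3 h2 (h1.trans_le h2) (by linarith)
      (by positivity)
    rw [show -(((s : ℝ) - b - 2 * l - 1) / 2 + ((b : ℝ) + 2 * l) / 2) = (1 - (s : ℝ)) / 2 by ring]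
      at key
    have e1 : (1 - α ^ 2) ^ (((s : ℝ) - b - 2 * l) / 2) =
        (1 - α ^ 2) ^ ((1 : ℝ) / 2) * (1 - α ^ 2) ^ (((s : ℝ) - b - 2 * l - 1) / 2) := by
      rw [← rpow_add hα2]; ring_nf
    have e2 : (1 - t) ^ (((j : ℝ) - 3 + 2 * b + 2 * l) / 2) =
        (1 - t) ^ (((j : ℝ) - 3 + b) / 2) * (1 - t) ^ (((b : ℝ) + 2 * l) / 2) := by
      rw [← rpow_add h1]; ring_nf
    have hnn : 0 ≤ (1 - α ^ 2) ^ ((1 : ℝ) / 2) *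
        ((1 - t) ^ (((j : ℝ) - 3 + b) / 2) * t ^ (((d : ℝ) - j - 2 + 2 * l) / 2)) := by
      positivity
    have hmul := mul_le_mul_of_nonneg_left key hnn
    simp only [e1, e2]
    linarith
end

section
/- Let d, j, b, l be integers with 1 < j < d, b ≥ 0, l ≥ 0, and set s := b + 2l. Then lim_{α→1⁻} ∫₀¹ t^{j-2+2b+2l} ((1-α²) + α²t²)^{(1-s)/2} (1-t²)^{(d-j-2)/2 + l} dt = Γ((j+b)/2) Γ((d-j+2l)/2) / (2 Γ((d+b+2l)/2)), where the limit is taken as α increases to 1 with α ∈ [0,1). -/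
open MeasureTheory Real Filter

lemma ofReal_betaIntegrand {u v x : ℝ} (hx : x ∈ Set.Ioo (0 : ℝ) 1) :
    (x : ℂ) ^ ((u : ℂ) - 1) * (1 - (x : ℂ)) ^ ((v : ℂ) - 1) =
      ((x ^ (u - 1) * (1 - x) ^ (v - 1) : ℝ) : ℂ) := by
  rw [Complex.ofReal_mul, Complex.ofReal_cpow hx.1.le, Complex.ofReal_cpow (sub_nonneg.2 hx.2.le)]
  push_cast
  rfl

lemma integrableOn_betaIntegrand {u v : ℝ} (hu : 0 < u) (hv : 0 < v) :
    IntegrableOn (fun x : ℝ => x ^ (u - 1) * (1 - x) ^ (v - 1)) (Set.Ioo 0 1) := by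
  have h := Complex.betaIntegral_convergent (u := u) (v := v) (by simpa) (by simpa)
  rw [intervalIntegrable_iff_integrableOn_Ioo_of_le zero_le_one] at h
  exact (IntegrableOn.congr_fun h (fun x hx => ofReal_betaIntegrand hx) measurableSet_Ioo).re

lemma integral_betaIntegrand {u v : ℝ} (hu : 0 < u) (hv : 0 < v) :
    ∫ x in Set.Ioo (0 : ℝ) 1, x ^ (u - 1) * (1 - x) ^ (v - 1) =
      Gamma u * Gamma v / Gamma (u + v) := by
  have h := Complex.betaIntegral_eq_Gamma_mul_div u v (by simpa) (by simpa)
  rw [Complex.betaIntegral, intervalIntegral.integral_of_le zero_le_one,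
    integral_Ioc_eq_integral_Ioo,
    setIntegral_congr_fun measurableSet_Ioo (fun x hx => ofReal_betaIntegrand hx),
    integral_complex_ofReal, ← Complex.ofReal_add] at h
  simp only [Complex.Gamma_ofReal] at h
  exact_mod_cast h

lemma image_sq_Ioo_zero_one : (fun t : ℝ => t ^ 2) '' Set.Ioo 0 1 = Set.Ioo 0 1 := by
  ext x
  constructor
  · rintro ⟨t, ⟨h0, h1⟩, rfl⟩
    exact ⟨by positivity, by dsimp only; nlinarith⟩
  · rintro ⟨h0, h1⟩
    refine ⟨√x, ⟨sqrt_pos.2 h0, ?_⟩, sq_sqrt h0.le⟩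
    rwa [sqrt_lt' one_pos, one_pow]

lemma hasDerivWithinAt_sq_Ioo (t : ℝ) (_ : t ∈ Set.Ioo (0 : ℝ) 1) :
    HasDerivWithinAt (fun t : ℝ => t ^ 2) (2 * t) (Set.Ioo 0 1) t := by
  simpa using (hasDerivAt_pow 2 t).hasDerivWithinAt

lemma injOn_sq_Ioo : Set.InjOn (fun t : ℝ => t ^ 2) (Set.Ioo 0 1) :=
  fun _ hx _ hy h => (pow_left_inj₀ hx.1.le hy.1.le two_ne_zero).1 h

lemma betaIntegrand_comp_sq {u v t : ℝ} (ht : t ∈ Set.Ioo (0 : ℝ) 1) :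
    |2 * t| • ((t ^ 2) ^ (u - 1) * (1 - t ^ 2) ^ (v - 1)) =
      2 * (t ^ (2 * u - 1) * (1 - t ^ 2) ^ (v - 1)) := by
  have ht0 := ht.1
  have h : t ^ (2 * u - 1) = t * (t ^ 2) ^ (u - 1) := by
    rw [← rpow_two, ← rpow_mul ht0.le, show 2 * u - 1 = 1 + 2 * (u - 1) by ring, rpow_add ht0, rpow_one]
  rw [h, abs_of_pos (by positivity), smul_eq_mul]
  ring

lemma integrableOn_rpow_mul_one_sub_sq_rpow {u v : ℝ} (hu : 0 < u) (hv : 0 < v) :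
    IntegrableOn (fun t : ℝ => t ^ (2 * u - 1) * (1 - t ^ 2) ^ (v - 1)) (Set.Ioo 0 1) := by
  have h := integrableOn_betaIntegrand hu hv
  rw [← image_sq_Ioo_zero_one, integrableOn_image_iff_integrableOn_abs_deriv_smul
    measurableSet_Ioo hasDerivWithinAt_sq_Ioo injOn_sq_Ioo] at h
  have h2 := (IntegrableOn.congr_fun h (fun t ht => betaIntegrand_comp_sq ht)
    measurableSet_Ioo).const_mul (1 / 2)
  simpa [IntegrableOn] using h2

lemma integral_rpow_mul_one_sub_sq_rpow {u v : ℝ} (hu : 0 < u) (hv : 0 < v) :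
    ∫ t in Set.Ioo (0 : ℝ) 1, t ^ (2 * u - 1) * (1 - t ^ 2) ^ (v - 1) =
      Gamma u * Gamma v / (2 * Gamma (u + v)) := by
  have h := integral_betaIntegrand hu hv
  rw [← image_sq_Ioo_zero_one, integral_image_eq_integral_abs_deriv_smul
    measurableSet_Ioo hasDerivWithinAt_sq_Ioo injOn_sq_Ioo,
    setIntegral_congr_fun measurableSet_Ioo (fun t ht => betaIntegrand_comp_sq ht),
    integral_const_mul] at h
  rw [mul_comm 2 (Gamma _), ← div_div, ← h]
  ring

/-- On `(0, 1)` the base `(1 - α²) + α² t²` lies between `t²` and `1`. -/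
lemma interpolated_sq_rpow_le {α t : ℝ} (p : ℝ) (hα : α ∈ Set.Ico (0 : ℝ) 1)
    (ht : t ∈ Set.Ioo (0 : ℝ) 1) :
    ((1 - α ^ 2) + α ^ 2 * t ^ 2) ^ p ≤ t ^ (2 * p) + 1 := by
  obtain ⟨ht0, ht1⟩ := ht
  have hα2 : α ^ 2 ≤ 1 := by nlinarith [hα.1, hα.2]
  have ht2 : t ^ 2 ≤ 1 := by nlinarith
  have hlow : t ^ 2 ≤ (1 - α ^ 2) + α ^ 2 * t ^ 2 := by
    nlinarith [mul_nonneg (sub_nonneg.2 hα2) (sub_nonneg.2 ht2)]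
  have hup : (1 - α ^ 2) + α ^ 2 * t ^ 2 ≤ 1 := by
    nlinarith [mul_nonneg (sq_nonneg α) (sub_nonneg.2 ht2)]
  have hsq : t ^ (2 * p) = (t ^ 2) ^ p := by
    rw [rpow_mul ht0.le, rpow_two]
  rcases le_total p 0 with hp | hp
  · have := rpow_le_rpow_of_nonpos (by positivity) hlow hp
    linarith
  · have := rpow_le_one ((sq_nonneg t).trans hlow) hup hp
    have := rpow_nonneg ht0.le (2 * p)
    linarith

lemma tendsto_integral_interpolated_sq {e p v : ℝ} (he : 0 < e + 1) (hep : 0 < e + 2 * p + 1)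
    (hv : 0 < v) :
    Tendsto (fun α : ℝ => ∫ t in Set.Ioo (0 : ℝ) 1,
        t ^ e * ((1 - α ^ 2) + α ^ 2 * t ^ 2) ^ p * (1 - t ^ 2) ^ (v - 1))
      (nhdsWithin 1 (Set.Ico (0 : ℝ) 1))
      (nhds (∫ t in Set.Ioo (0 : ℝ) 1, t ^ (e + 2 * p) * (1 - t ^ 2) ^ (v - 1))) := by
  have hint : ∀ {a : ℝ}, 0 < a + 1 →
      IntegrableOn (fun t : ℝ => t ^ a * (1 - t ^ 2) ^ (v - 1)) (Set.Ioo 0 1) := fun {a} ha => by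
    have := integrableOn_rpow_mul_one_sub_sq_rpow (u := (a + 1) / 2) (by linarith) hv
    rwa [show 2 * ((a + 1) / 2) - 1 = a by ring] at this
  refine tendsto_integral_filter_of_dominated_convergence
    (fun t => t ^ (e + 2 * p) * (1 - t ^ 2) ^ (v - 1) + t ^ e * (1 - t ^ 2) ^ (v - 1))
    (Eventually.of_forall fun α => Measurable.aestronglyMeasurable (by fun_prop)) ?_
    (Integrable.add (hint hep) (hint he)) ?_
  · filter_upwards [self_mem_nhdsWithin] with α hα
    filter_upwards [ae_restrict_mem measurableSet_Ioo] with t ht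
    have ht0 : 0 < t := ht.1
    have hα2 : 0 ≤ 1 - α ^ 2 := by nlinarith [hα.1, hα.2]
    have ht2 : 0 ≤ 1 - t ^ 2 := by nlinarith [ht.1, ht.2]
    rw [norm_of_nonneg (by positivity)]
    calc _ ≤ t ^ e * (t ^ (2 * p) + 1) * (1 - t ^ 2) ^ (v - 1) := by
          gcongr
          exact interpolated_sq_rpow_le p hα ht
      _ = _ := by
          rw [rpow_add ht0]
          ring
  · filter_upwards [ae_restrict_mem measurableSet_Ioo] with t ht
    have ht0 : 0 < t := ht.1
    have hbase : Tendsto (fun α : ℝ => (1 - α ^ 2) + α ^ 2 * t ^ 2)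
        (nhdsWithin 1 (Set.Ico (0 : ℝ) 1)) (nhds (t ^ 2)) := by
      have : Continuous fun α : ℝ => (1 - α ^ 2) + α ^ 2 * t ^ 2 := by fun_prop
      simpa using (this.tendsto 1).mono_left nhdsWithin_le_nhds
    have hlim := ((hbase.rpow_const (p := p) (Or.inl (by positivity))).const_mul (t ^ e)).mul_const
      ((1 - t ^ 2) ^ (v - 1))
    rwa [← rpow_two, ← rpow_mul ht0.le, ← rpow_add ht0, rpow_two] at hlim

theorem statement3 (d j b l : ℕ) (hj : 1 < j) (hjd : j < d) :
    Filter.Tendsto (fun α : ℝ =>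
        ∫ t in Set.Ioo (0 : ℝ) 1,
          t ^ ((j : ℝ) - 2 + 2 * b + 2 * l) *
            ((1 - α ^ 2) + α ^ 2 * t ^ 2) ^ ((1 - ((b : ℝ) + 2 * l)) / 2) *
            (1 - t ^ 2) ^ (((d : ℝ) - j - 2) / 2 + l))
      (nhdsWithin 1 (Set.Ico (0 : ℝ) 1))
      (nhds (Real.Gamma (((j : ℝ) + b) / 2) * Real.Gamma (((d : ℝ) - j + 2 * l) / 2) /
        (2 * Real.Gamma (((d : ℝ) + b + 2 * l) / 2)))) := by
  have hj' : (1 : ℝ) < j := by exact_mod_cast hj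
  have hjd' : (j : ℝ) < d := by exact_mod_cast hjd
  have hb : (0 : ℝ) ≤ b := b.cast_nonneg
  have hl : (0 : ℝ) ≤ l := l.cast_nonneg
  have hv : 0 < ((d : ℝ) - j + 2 * l) / 2 := by linarith
  have h := tendsto_integral_interpolated_sq (e := (j : ℝ) - 2 + 2 * b + 2 * l)
    (p := (1 - ((b : ℝ) + 2 * l)) / 2) (by linarith) (by linarith) hv
  rw [show (j : ℝ) - 2 + 2 * b + 2 * l + 2 * ((1 - ((b : ℝ) + 2 * l)) / 2) =
      2 * (((j : ℝ) + b) / 2) - 1 by ring,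
    integral_rpow_mul_one_sub_sq_rpow (by linarith) hv,
    show ((d : ℝ) - j + 2 * l) / 2 - 1 = ((d : ℝ) - j - 2) / 2 + l by ring,
    show ((j : ℝ) + b) / 2 + ((d : ℝ) - j + 2 * l) / 2 = ((d : ℝ) + b + 2 * l) / 2 by ring] at h
  exact h
end

section
/- Let x, n ∈ ℝ³ be unit vectors that are linearly independent and satisfy ⟨x,n⟩ ≠ 0, so that α := √(1 - ⟨x,n⟩²) ∈ (0,1). Then for every unit vector a ∈ ℝ³ with ⟨a,n⟩ = 0: ∫_{S¹(x⊥)} ⟨u,a⟩² / (1 - ⟨n,u⟩²) dH¹(u) = π · [ 2(1 - √(1-α²))/α² − 2((√(1-α²) - 1)²/α⁴) · ⟨x,a⟩² ]. -/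
open MeasureTheory Real Filter
open scoped RealInnerProductSpace

/-- The arclength parametrisation of the unit circle spanned by `e` and `f`. -/
noncomputable def circleParam {E : Type*} [NormedAddCommGroup E] [InnerProductSpace ℝ E]
    (e f : E) (θ : ℝ) : E := cos θ • e + sin θ • f

section circleParam

variable {E : Type*} [NormedAddCommGroup E] [InnerProductSpace ℝ E] {e f : E}

theorem continuous_circleParam : Continuous (circleParam e f) := by
  unfold circleParam
  fun_prop

theorem dist_circleParam (he : ‖e‖ = 1) (hf : ‖f‖ = 1) (hef : ⟪e, f⟫ = 0) (s t : ℝ) :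
    dist (circleParam e f s) (circleParam e f t) = 2 * |sin ((s - t) / 2)| := by
  have h : circleParam e f s - circleParam e f t =
      (cos s - cos t) • e + (sin s - sin t) • f := by
    simp only [circleParam]
    module
  have hs : sin ((s - t) / 2) ^ 2 = 1 / 2 - cos (s - t) / 2 := by
    rw [sin_sq_eq_half_sub]
    ring_nf
  rw [dist_eq_norm, ← sq_eq_sq₀ (norm_nonneg _) (by positivity), mul_pow, sq_abs, hs, h,
    norm_add_sq_real, norm_smul, norm_smul, inner_smul_left, inner_smul_right, hef, he, hf,
    cos_sub]
  simp only [Real.norm_eq_abs, mul_one, sq_abs, mul_zero]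
  linear_combination sin_sq_add_cos_sq s + sin_sq_add_cos_sq t

theorem lipschitzWith_circleParam (he : ‖e‖ = 1) (hf : ‖f‖ = 1) (hef : ⟪e, f⟫ = 0) :
    LipschitzWith 1 (circleParam e f) := by
  refine LipschitzWith.of_dist_le_mul fun s t => ?_
  rw [dist_circleParam he hf hef, NNReal.coe_one, one_mul, Real.dist_eq]
  have h := abs_sin_le_abs (x := (s - t) / 2)
  rw [abs_div, abs_two] at h
  linarith

theorem abs_sub_le_dist_circleParam (he : ‖e‖ = 1) (hf : ‖f‖ = 1) (hef : ⟪e, f⟫ = 0)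
    {s t δ : ℝ} (hst : |s - t| ≤ δ) :
    (1 - δ ^ 2 / 24) * |s - t| ≤ dist (circleParam e f s) (circleParam e f t) := by
  rw [dist_circleParam he hf hef]
  have key : ∀ r : ℝ, 0 ≤ r → r ≤ δ → (1 - δ ^ 2 / 24) * r ≤ 2 * |sin (r / 2)| := by
    intro r hr hrδ
    rcases hr.eq_or_lt with rfl | hr
    · simp
    have h1 := sin_gt_sub_cube (half_pos hr)
    have h2 := le_abs_self (sin (r / 2))
    have h3 : r ^ 2 * r ≤ δ ^ 2 * r := by gcongr
    nlinarith
  have h := key _ (abs_nonneg _) hst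
  have h' : |sin (|s - t| / 2)| = |sin ((s - t) / 2)| := by
    rcases abs_cases (s - t) with ⟨h, _⟩ | ⟨h, _⟩
    · rw [h]
    · rw [h, neg_div, sin_neg, abs_neg]
  rwa [h'] at h

theorem injOn_circleParam (he : ‖e‖ = 1) (hf : ‖f‖ = 1) (hef : ⟪e, f⟫ = 0) :
    Set.InjOn (circleParam e f) (Set.Ioc (-π) π) := by
  intro s hs t ht hst
  have h := dist_circleParam he hf hef s t
  rw [hst, dist_self] at h
  have h0 : sin ((s - t) / 2) = 0 := by
    rw [← abs_eq_zero]
    linarith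
  rw [sin_eq_zero_iff_of_lt_of_lt (by linarith [hs.1, ht.2]) (by linarith [hs.2, ht.1])] at h0
  linarith

variable [MeasurableSpace E] [BorelSpace E]

/-- On short arcs, the circle parametrisation almost preserves length. -/
theorem volume_le_hausdorffMeasure_image_circleParam_of_subset
    (he : ‖e‖ = 1) (hf : ‖f‖ = 1) (hef : ⟪e, f⟫ = 0)
    {A : Set ℝ} {δ : ℝ} (hδ1 : δ ^ 2 < 24) (hA : ∀ s ∈ A, ∀ t ∈ A, |s - t| ≤ δ) :
    volume A ≤ ENNReal.ofReal (1 - δ ^ 2 / 24)⁻¹ * μH[1] (circleParam e f '' A) := by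
  have hpos : 0 < 1 - δ ^ 2 / 24 := by linarith
  have hbound : ∀ s ∈ A, ∀ t ∈ A,
      |s - t| ≤ (1 - δ ^ 2 / 24)⁻¹ * dist (circleParam e f s) (circleParam e f t) := by
    intro s hs t ht
    rw [← div_eq_inv_mul, le_div_iff₀' hpos]
    exact abs_sub_le_dist_circleParam he hf hef (hA s hs t ht)
  have hinj : Set.InjOn (circleParam e f) A := by
    intro s hs t ht hst
    have h := hbound s hs t ht
    rw [hst, dist_self, mul_zero] at h
    exact sub_eq_zero.1 (abs_nonpos_iff.1 h)
  have hleft := hinj.leftInvOn_invFunOn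
  have hlip : LipschitzOnWith (1 - δ ^ 2 / 24)⁻¹.toNNReal
      (Function.invFunOn (circleParam e f) A) (circleParam e f '' A) := by
    refine LipschitzOnWith.of_dist_le_mul ?_
    rintro _ ⟨s, hs, rfl⟩ _ ⟨t, ht, rfl⟩
    rw [hleft hs, hleft ht, Real.dist_eq, Real.coe_toNNReal _ (by positivity)]
    exact hbound s hs t ht
  have h := hlip.hausdorffMeasure_image_le zero_le_one
  rwa [hleft.image_image, ENNReal.rpow_one, hausdorffMeasure_real] at h

theorem hausdorffMeasure_image_circleParam (he : ‖e‖ = 1) (hf : ‖f‖ = 1) (hef : ⟪e, f⟫ = 0)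
    {A : Set ℝ} (hA : MeasurableSet A) (hAπ : A ⊆ Set.Ioc (-π) π) :
    μH[1] (circleParam e f '' A) = volume A := by
  have hinj := (injOn_circleParam he hf hef).mono hAπ
  refine le_antisymm ?_ ?_
  · simpa [hausdorffMeasure_real] using
      (lipschitzWith_circleParam he hf hef).hausdorffMeasure_image_le zero_le_one A
  have hle : ∀ δ : ℝ, 0 < δ → δ < 1 →
      volume A ≤ ENNReal.ofReal (1 - δ ^ 2 / 24)⁻¹ * μH[1] (circleParam e f '' A) := by
    intro δ hδ hδ1
    set I : ℤ → Set ℝ := fun m => A ∩ Set.Ioc (m • δ) ((m + 1) • δ) with hI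
    have hIm : ∀ m, MeasurableSet (I m) := fun m => hA.inter measurableSet_Ioc
    have hdisj : Pairwise (Function.onFun Disjoint I) := fun m m' hmm =>
      (Set.pairwise_disjoint_Ioc_zsmul δ hmm).mono Set.inter_subset_right Set.inter_subset_right
    have hAI : A = ⋃ m, I m := by
      rw [hI, ← Set.inter_iUnion, iUnion_Ioc_zsmul hδ, Set.inter_univ]
    have hIA : ∀ m, I m ⊆ A := fun m => Set.inter_subset_left
    have him : μH[1] (circleParam e f '' A) = ∑' m, μH[1] (circleParam e f '' I m) := by
      conv_lhs => rw [hAI, Set.image_iUnion]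
      refine measure_iUnion (fun m m' hmm => ?_) fun m =>
        (hIm m).image_of_continuousOn_injOn continuous_circleParam.continuousOn
          (hinj.mono (hIA m))
      rw [Function.onFun, Set.disjoint_iff_inter_eq_empty, ← hinj.image_inter (hIA m) (hIA m'),
        (hdisj hmm).inter_eq, Set.image_empty]
    have hvol : volume A = ∑' m, volume (I m) := by
      conv_lhs => rw [hAI, measure_iUnion hdisj hIm]
    rw [him, hvol, ← ENNReal.tsum_mul_left]
    refine ENNReal.tsum_le_tsum fun m =>
      volume_le_hausdorffMeasure_image_circleParam_of_subset he hf hef (by nlinarith) ?_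
    rintro s ⟨-, hs⟩ t ⟨-, ht⟩
    rw [add_smul, one_smul] at hs ht
    rw [abs_le]
    constructor <;> linarith [hs.1, hs.2, ht.1, ht.2]
  have hlim : Tendsto
      (fun δ : ℝ => ENNReal.ofReal (1 - δ ^ 2 / 24)⁻¹ * μH[1] (circleParam e f '' A))
      (nhdsWithin 0 (Set.Ioi 0)) (nhds (1 * μH[1] (circleParam e f '' A))) := by
    refine ENNReal.Tendsto.mul_const ?_ (Or.inl one_ne_zero)
    have hc : ContinuousAt (fun δ : ℝ => (1 - δ ^ 2 / 24)⁻¹) 0 :=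
      ContinuousAt.inv₀ (by fun_prop) (by norm_num)
    simpa using (ENNReal.tendsto_ofReal hc.tendsto).mono_left nhdsWithin_le_nhds
  rw [one_mul] at hlim
  refine ge_of_tendsto hlim ?_
  filter_upwards [Ioo_mem_nhdsGT one_pos] with δ hδ using hle δ hδ.1 hδ.2

/-- Arclength on the circle is the push-forward of Lebesgue measure. -/
theorem hausdorffMeasure_restrict_image_circleParam
    (he : ‖e‖ = 1) (hf : ‖f‖ = 1) (hef : ⟪e, f⟫ = 0) :
    μH[1].restrict (circleParam e f '' Set.Ioc (-π) π) =
      (volume.restrict (Set.Ioc (-π) π)).map (circleParam e f) := by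
  have hm : Measurable (circleParam e f) := continuous_circleParam.measurable
  ext S hS
  rw [Measure.restrict_apply hS, Measure.map_apply hm hS, Measure.restrict_apply (hm hS),
    Set.inter_comm S, ← Set.image_inter_preimage, Set.inter_comm]
  exact hausdorffMeasure_image_circleParam he hf hef ((hm hS).inter measurableSet_Ioc)
    Set.inter_subset_right

end circleParam

theorem integral_sq_div_sin_sq_add {k : ℝ} (hk : 0 < k) (hk1 : k < 1) (q p : ℝ) :
    ∫ θ in (-π)..π, (q * cos θ + p * sin θ) ^ 2 / (1 - (1 - k ^ 2) * cos θ ^ 2) =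
      2 * π * (q ^ 2 + p ^ 2 * k) / (k * (1 + k)) := by
  have hs : 0 < 1 - k ^ 2 := by nlinarith
  have hD : ∀ θ : ℝ, 0 < 1 - (1 - k ^ 2) * cos θ ^ 2 := fun θ => by
    nlinarith [cos_sq_le_one θ, mul_pos hk hk]
  have hE : ∀ θ : ℝ, 0 < k * cos θ ^ 2 + sin θ ^ 2 := fun θ => by
    nlinarith [cos_sq_le_one θ, sin_sq_add_cos_sq θ, mul_pos hk hk, sq_nonneg (sin θ)]
  set A : ℝ := p ^ 2 + (q ^ 2 - p ^ 2) / (1 - k ^ 2) with hA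
  set B : ℝ := -((q ^ 2 - p ^ 2) / (1 - k ^ 2)) with hB
  set G : ℝ → ℝ := fun θ =>
    A / k * (θ + arctan ((1 - k) * (sin θ * cos θ) / (k * cos θ ^ 2 + sin θ ^ 2))) + B * θ +
      q * p / (1 - k ^ 2) * log (1 - (1 - k ^ 2) * cos θ ^ 2) with hG
  have hd : ∀ θ : ℝ, HasDerivAt G
      ((q * cos θ + p * sin θ) ^ 2 / (1 - (1 - k ^ 2) * cos θ ^ 2)) θ := by
    intro θ
    have hs' := hasDerivAt_sin θ
    have hc' := hasDerivAt_cos θ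
    have h1 := (((hs'.mul hc').const_mul (1 - k)).div
      (((hc'.pow 2).const_mul k).add (hs'.pow 2)) (hE θ).ne').arctan
    have h2 := ((((hc'.pow 2).const_mul (1 - k ^ 2)).const_sub 1)).log (hD θ).ne'
    have h3 := ((((hasDerivAt_id θ).add h1).const_mul (A / k)).add
      ((hasDerivAt_id θ).const_mul B)).add (h2.const_mul (q * p / (1 - k ^ 2)))
    refine h3.congr_deriv ?_
    have hDθ := hD θ
    have hEθ := hE θ
    simp only [Pi.add_apply, Pi.mul_apply, Pi.div_apply, Pi.pow_apply]
    norm_num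
    have hsc := sin_sq_add_cos_sq θ
    generalize sin θ = s at *
    generalize cos θ = c at *
    have hc2 : c ^ 2 = 1 - s ^ 2 := by linarith
    have hED : (k * c ^ 2 + s ^ 2) ^ 2 + ((1 - k) * (s * c)) ^ 2 = 1 - (1 - k ^ 2) * c ^ 2 := by
      linear_combination (k ^ 2 * c ^ 2 + s ^ 2) * hsc + hsc
    have hX : (1 - k) * (c * c + -(s * s)) * (k * c ^ 2 + s ^ 2) -
        (1 - k) * (s * c) * (-(k * (2 * c * s)) + 2 * s * c) =
          k - (1 - (1 - k ^ 2) * c ^ 2) := by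
      linear_combination (1 - k) * (k * c ^ 2 - s ^ 2) * hsc - (1 - k) * hsc
    have hinv : (1 + ((1 - k) * (s * c) / (k * c ^ 2 + s ^ 2)) ^ 2)⁻¹ =
        (k * c ^ 2 + s ^ 2) ^ 2 / (1 - (1 - k ^ 2) * c ^ 2) := by
      rw [← hED, div_pow]
      field_simp
    rw [hX, hinv, div_mul_div_cancel₀' (by positivity), sub_div, div_self hDθ.ne']
    have hD2 : 1 - (1 - k ^ 2) * c ^ 2 ≠ 0 := hDθ.ne'
    have hnum : A + B * (1 - (1 - k ^ 2) * c ^ 2) + q * p * (2 * c * s) =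
        (q * c + p * s) ^ 2 := by
      rw [hA, hB]
      field_simp
      linear_combination (-p ^ 2) * (1 - k ^ 2) * hsc
    rw [← hnum]
    generalize 1 - (1 - k ^ 2) * c ^ 2 = D at *
    field_simp
    ring
  rw [intervalIntegral.integral_eq_sub_of_hasDerivAt (fun θ _ => hd θ)]
  · simp only [hG, sin_pi, cos_pi, sin_neg, cos_neg]
    simp
    rw [hA, hB]
    field_simp
    ring
  · refine Continuous.intervalIntegrable ?_ _ _
    exact Continuous.div (by fun_prop) (by fun_prop) fun θ => (hD θ).ne'

theorem image_circleParam_eq (b : OrthonormalBasis (Fin 3) ℝ (EuclideanSpace ℝ (Fin 3))) :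
    circleParam (b 1) (b 2) '' Set.Ioc (-π) π =
      {u : EuclideanSpace ℝ (Fin 3) | ‖u‖ = 1 ∧ ⟪u, b 0⟫ = 0} := by
  have hb : ∀ i j, ⟪b i, b j⟫ = if i = j then (1 : ℝ) else 0 :=
    orthonormal_iff_ite.1 b.orthonormal
  ext u
  constructor
  · rintro ⟨θ, -, rfl⟩
    refine ⟨?_, ?_⟩
    · rw [← sq_eq_sq₀ (norm_nonneg _) zero_le_one, ← real_inner_self_eq_norm_sq]
      simp only [circleParam, inner_add_left, inner_add_right, inner_smul_left, inner_smul_right,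
        hb]
      simp
      linear_combination sin_sq_add_cos_sq θ
    · simp only [circleParam, inner_add_left, inner_smul_left, hb]
      simp
  · rintro ⟨hu, hu0⟩
    have hnorm := b.sum_sq_norm_inner_left u
    simp only [Fin.sum_univ_three, Real.norm_eq_abs, sq_abs, hu0, hu] at hnorm
    set z : ℂ := ⟨⟪u, b 1⟫, ⟪u, b 2⟫⟩ with hz
    have hz1 : ‖z‖ = 1 := by
      rw [← sq_eq_sq₀ (norm_nonneg _) zero_le_one, Complex.sq_norm, Complex.normSq_mk]
      linarith
    have hz0 : z ≠ 0 := by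
      rintro h
      simp [h] at hz1
    refine ⟨z.arg, Complex.arg_mem_Ioc z, ?_⟩
    rw [circleParam, Complex.cos_arg hz0, Complex.sin_arg, hz1, div_one, div_one]
    conv_rhs => rw [← b.sum_repr' u]
    simp [Fin.sum_univ_three, real_inner_comm, hu0, hz]

/-- The unit circle orthogonal to `b 0` is parametrised by arclength. -/
theorem setIntegral_unit_circle (b : OrthonormalBasis (Fin 3) ℝ (EuclideanSpace ℝ (Fin 3)))
    {g : EuclideanSpace ℝ (Fin 3) → ℝ} (hg : Measurable g) :
    ∫ u in {u : EuclideanSpace ℝ (Fin 3) | ‖u‖ = 1 ∧ ⟪u, b 0⟫ = 0}, g u ∂μH[1] =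
      ∫ θ in (-π)..π, g (cos θ • b 1 + sin θ • b 2) := by
  rw [← image_circleParam_eq, hausdorffMeasure_restrict_image_circleParam (b.norm_eq_one 1)
    (b.norm_eq_one 2) (b.inner_eq_zero (by decide)),
    integral_map continuous_circleParam.aemeasurable hg.aestronglyMeasurable,
    intervalIntegral.integral_of_le (by linarith [pi_pos])]
  rfl

theorem exists_orthonormalBasis_of_orthonormal_pair {x e : EuclideanSpace ℝ (Fin 3)}
    (hx : ‖x‖ = 1) (he : ‖e‖ = 1) (hxe : ⟪x, e⟫ = 0) :
    ∃ b : OrthonormalBasis (Fin 3) ℝ (EuclideanSpace ℝ (Fin 3)), b 0 = x ∧ b 1 = e := by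
  have hv : Orthonormal ℝ (({0, 1} : Set (Fin 3)).domRestrict ![x, e, 0]) := by
    refine ⟨?_, ?_⟩
    · rintro ⟨i, rfl | rfl⟩ <;> simp [hx, he]
    · rintro ⟨i, rfl | rfl⟩ ⟨j, rfl | rfl⟩ hij <;>
        simp_all [real_inner_comm]
  obtain ⟨b, hb⟩ := hv.exists_orthonormalBasis_extension_of_card_eq (by simp)
  exact ⟨b, by simpa using hb 0 (by simp), by simpa using hb 1 (by simp)⟩

theorem statement9 (x n : EuclideanSpace ℝ (Fin 3)) (hx : ‖x‖ = 1) (hn : ‖n‖ = 1)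
    (hind : LinearIndependent ℝ ![x, n]) (hxn : ⟪x, n⟫ ≠ 0)
    (α : ℝ) (hα : α = Real.sqrt (1 - ⟪x, n⟫ ^ 2))
    (a : EuclideanSpace ℝ (Fin 3)) (ha : ‖a‖ = 1) (han : ⟪a, n⟫ = 0) :
    (∫ u in {u : EuclideanSpace ℝ (Fin 3) | ‖u‖ = 1 ∧ ⟪u, x⟫ = 0},
        ⟪u, a⟫ ^ 2 / (1 - ⟪n, u⟫ ^ 2)
        ∂(MeasureTheory.Measure.hausdorffMeasure 1)) =
      Real.pi * (2 * (1 - Real.sqrt (1 - α ^ 2)) / α ^ 2 -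
        2 * ((Real.sqrt (1 - α ^ 2) - 1) ^ 2 / α ^ 4) * ⟪x, a⟫ ^ 2) := by
  set c : ℝ := ⟪x, n⟫ with hc
  have hxx : ⟪x, x⟫ = 1 := by rw [real_inner_self_eq_norm_sq, hx, one_pow]
  have hnn : ⟪n, n⟫ = 1 := by rw [real_inner_self_eq_norm_sq, hn, one_pow]
  have hnx : ⟪n, x⟫ = c := real_inner_comm _ _
  have hw : ‖n - c • x‖ ^ 2 = 1 - c ^ 2 := by
    rw [← real_inner_self_eq_norm_sq]
    simp only [inner_sub_left, inner_sub_right, inner_smul_left, inner_smul_right, hxx, hnn, hnx,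
      ← hc]
    simp
    ring
  have hw0 : n - c • x ≠ 0 := by
    intro h
    have h1 := LinearIndependent.pair_iff.1 hind (-c) 1 (by rw [← h]; module)
    exact one_ne_zero h1.2
  have hpos : 0 < 1 - c ^ 2 := by
    rw [← hw]
    exact pow_pos (norm_pos_iff.2 hw0) 2
  have hα0 : 0 < α := hα ▸ Real.sqrt_pos.2 hpos
  have hα2 : α ^ 2 = 1 - c ^ 2 := by rw [hα, Real.sq_sqrt hpos.le]
  have hnormw : ‖n - c • x‖ = α := by
    rw [← sq_eq_sq₀ (norm_nonneg _) hα0.le, hw, hα2]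
  obtain ⟨b, hb0, hb1⟩ := exists_orthonormalBasis_of_orthonormal_pair
    (x := x) (e := α⁻¹ • (n - c • x)) hx
    (by rw [norm_smul, hnormw, Real.norm_eq_abs, abs_of_pos (by positivity),
      inv_mul_cancel₀ hα0.ne'])
    (by rw [inner_smul_right, inner_sub_right, inner_smul_right, hxx, ← hc]; ring)
  have hnb : n = c • b 0 + α • b 1 := by
    rw [hb0, hb1, smul_smul, mul_inv_cancel₀ hα0.ne']
    module
  have hb : ∀ i j, ⟪b i, b j⟫ = if i = j then (1 : ℝ) else 0 :=
    orthonormal_iff_ite.1 b.orthonormal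
  have hnu : ∀ θ : ℝ, ⟪n, cos θ • b 1 + sin θ • b 2⟫ = α * cos θ := by
    intro θ
    simp only [hnb, inner_add_left, inner_add_right, inner_smul_left, inner_smul_right, hb]
    simp [mul_comm]
  have hua : ∀ θ : ℝ, ⟪cos θ • b 1 + sin θ • b 2, a⟫ = ⟪b 1, a⟫ * cos θ + ⟪b 2, a⟫ * sin θ := by
    intro θ
    simp only [inner_add_left, inner_smul_left]
    simp [mul_comm]
  have hnorm := b.sum_sq_norm_inner_right a
  simp only [Fin.sum_univ_three, Real.norm_eq_abs, sq_abs, ha, one_pow] at hnorm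
  have horth : c * ⟪b 0, a⟫ + α * ⟪b 1, a⟫ = 0 := by
    rw [← han, real_inner_comm n a, hnb, inner_add_left, inner_smul_left, inner_smul_left]
    simp
  have hk : √(1 - α ^ 2) = |c| := by rw [hα2, sub_sub_cancel, Real.sqrt_sq_eq_abs]
  have hk0 : 0 < |c| := abs_pos.2 hxn
  have hk1 : |c| < 1 := by
    rw [← sq_lt_one_iff₀ (abs_nonneg c), sq_abs]
    linarith
  have hαk : α ^ 2 = 1 - |c| ^ 2 := by rw [hα2, sq_abs]
  have hint := setIntegral_unit_circle b
    (g := fun u => ⟪u, a⟫ ^ 2 / (1 - ⟪n, u⟫ ^ 2)) (by fun_prop)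
  simp only [hnu, hua, mul_pow, hαk] at hint
  rw [integral_sq_div_sin_sq_add hk0 hk1, hb0] at hint
  rw [hb0] at hnorm horth
  rw [hint, hk, show α ^ 4 = (α ^ 2) ^ 2 by ring, hαk]
  have hq : (1 - |c| ^ 2) * ⟪b 1, a⟫ ^ 2 = |c| ^ 2 * ⟪x, a⟫ ^ 2 := by
    rw [← hαk, sq_abs]
    linear_combination (α * ⟪b 1, a⟫ - c * ⟪x, a⟫) * horth
  generalize |c| = k at *
  have hk' : 1 - k ≠ 0 := by linarith
  have hk'' : 1 + k ≠ 0 := by linarith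
  have hp : ⟪b 2, a⟫ ^ 2 = 1 - ⟪x, a⟫ ^ 2 - ⟪b 1, a⟫ ^ 2 := by linarith
  have hq' : ⟪b 1, a⟫ ^ 2 = k ^ 2 * ⟪x, a⟫ ^ 2 / ((1 - k) * (1 + k)) := by
    rw [eq_div_iff (mul_ne_zero hk' hk'')]
    linarith
  rw [hp, hq', show 1 - k ^ 2 = (1 - k) * (1 + k) by ring]
  field_simp
  ring
end

section
/- Let d, j, k be integers with k ≥ 0, k + 2 < j and j ≤ d - 1. Then for every α ∈ [0,1]: ∫₀¹ t^{j-2} (1-t²)^{(d-j-2)/2} ((1-α²) + α²t²)^{(2-j+k)/2} dt ≤ ∫₀¹ (1-t²)^{(d-j-2)/2} t^{k} dt, and the integral on the right-hand side is finite. -/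
open MeasureTheory Real Filter

lemma integrableOn_one_sub_sq_rpow_mul_rpow {p q : ℝ} (hp : -1 < p) (hq : 0 ≤ q) :
    IntegrableOn (fun t : ℝ => (1 - t ^ 2) ^ p * t ^ q) (Set.Ioo 0 1) := by
  have h₁ : IntervalIntegrable (fun t : ℝ => (1 - t) ^ p) volume 0 1 := by
    simpa using
      ((intervalIntegral.intervalIntegrable_rpow' (a := 0) (b := 1) hp).comp_sub_left 1).symm
  have h₂ : ContinuousOn (fun t : ℝ => (1 + t) ^ p * t ^ q) (Set.uIcc 0 1) := by
    rw [Set.uIcc_of_le zero_le_one]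
    refine ContinuousOn.mul ?_ (continuous_id.rpow_const fun _ => Or.inr hq).continuousOn
    refine ContinuousOn.rpow_const (by fun_prop) fun t ht => Or.inl ?_
    linarith [ht.1]
  have h₃ := (intervalIntegrable_iff_integrableOn_Ioo_of_le zero_le_one).1 (h₁.mul_continuousOn h₂)
  refine h₃.congr_fun (fun t ht => ?_) measurableSet_Ioo
  have h : 1 - t ^ 2 = (1 - t) * (1 + t) := by ring
  simp only [h, mul_rpow (sub_nonneg.2 ht.2.le) (by linarith [ht.1] : (0 : ℝ) ≤ 1 + t), mul_assoc]

lemma rpow_mul_convex_comb_rpow_le {a q t α : ℝ} (haq : q ≤ a) (ht : t ∈ Set.Ioo (0 : ℝ) 1)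
    (hα : α ∈ Set.Icc (0 : ℝ) 1) :
    t ^ a * ((1 - α ^ 2) + α ^ 2 * t ^ 2) ^ ((q - a) / 2) ≤ t ^ q := by
  obtain ⟨h₀, h₁⟩ := ht
  have hα₂ : 0 ≤ 1 - α ^ 2 := by nlinarith [hα.1, hα.2]
  have ht₂ : 0 ≤ 1 - t ^ 2 := by nlinarith
  have hle : t ^ 2 ≤ (1 - α ^ 2) + α ^ 2 * t ^ 2 := by nlinarith [mul_nonneg hα₂ ht₂]
  calc t ^ a * ((1 - α ^ 2) + α ^ 2 * t ^ 2) ^ ((q - a) / 2)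
      ≤ t ^ a * (t ^ 2) ^ ((q - a) / 2) := by
        gcongr ?_ * ?_
        exact rpow_le_rpow_of_nonpos (by positivity) hle (by linarith)
    _ = t ^ q := by
        rw [← rpow_natCast, ← rpow_mul h₀.le, ← rpow_add h₀]
        congr 1
        push_cast
        ring

theorem statement11 (d j k : ℕ) (hkj : k + 2 < j) (hjd : j ≤ d - 1) :
    (∀ α : ℝ, α ∈ Set.Icc (0 : ℝ) 1 →
      (∫ t in Set.Ioo (0 : ℝ) 1,
          t ^ ((j : ℝ) - 2) * (1 - t ^ 2) ^ (((d : ℝ) - j - 2) / 2) *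
            ((1 - α ^ 2) + α ^ 2 * t ^ 2) ^ ((2 - (j : ℝ) + k) / 2)) ≤
        ∫ t in Set.Ioo (0 : ℝ) 1, (1 - t ^ 2) ^ (((d : ℝ) - j - 2) / 2) * t ^ (k : ℝ)) ∧
    IntegrableOn
      (fun t : ℝ => (1 - t ^ 2) ^ (((d : ℝ) - j - 2) / 2) * t ^ (k : ℝ))
      (Set.Ioo 0 1) := by
  have hd : (j : ℝ) + 1 ≤ d := by exact_mod_cast (by omega : j + 1 ≤ d)
  have hk : (k : ℝ) + 2 ≤ j := by exact_mod_cast hkj.le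
  have hint := integrableOn_one_sub_sq_rpow_mul_rpow
    (p := ((d : ℝ) - j - 2) / 2) (by linarith) (Nat.cast_nonneg (α := ℝ) k)
  refine ⟨fun α hα => integral_mono_of_nonneg ?_ hint ?_, hint⟩
  · filter_upwards [ae_restrict_mem measurableSet_Ioo] with t ht
    have h₀ : 0 ≤ t := ht.1.le
    have ht₂ : 0 ≤ 1 - t ^ 2 := by nlinarith [ht.1, ht.2]
    have hα₂ : 0 ≤ 1 - α ^ 2 := by nlinarith [hα.1, hα.2]
    simp only [Pi.zero_apply]
    positivity
  · filter_upwards [ae_restrict_mem measurableSet_Ioo] with t ht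
    have ht₂ : 0 ≤ 1 - t ^ 2 := by nlinarith [ht.1, ht.2]
    have h := rpow_mul_convex_comb_rpow_le (a := (j : ℝ) - 2) (q := k) (by linarith) ht hα
    rw [show (k : ℝ) - (j - 2) = 2 - j + k by ring] at h
    rw [mul_comm (t ^ ((j : ℝ) - 2)), mul_assoc]
    gcongr
end
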